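/- Let f : ℝ → ℝ be infinitely differentiable with compact support, let τ > 0 and β > 0, and let u(τ,ξ) = (1/(2√(πτ))) ∫_ℝ exp(−(ξ−η)²/(4τ)) f(η) dη be the temperature field at time τ obtained from the initial field f. Then for every real x the series (e^{−x²/(4β)} / (2√(πβ))) · ∑_{j=0}^∞ (1/(2√β)^j) · H_j(x/(2√β)) · ((τ+β)^{j/2}/j!) · u_j converges, where u_j = ∫_ℝ H_j(ξ/(2√(τ+β))) u(τ,ξ) dξ, and its sum equals f(x); i.e., this series reconstructs the initial datum of the heat equation from the field at time τ. -/

import Mathlib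

open Real MeasureTheory

/-- The physicists' Hermite polynomial `H_j(z) = (-1)^j e^{z²} (d^j/dz^j) e^{-z²}`. -/
noncomputable def hermiteH (j : ℕ) (z : ℝ) : ℝ :=
  (-1) ^ j * Real.exp (z ^ 2) * iteratedDeriv j (fun t : ℝ => Real.exp (-t ^ 2)) z

theorem iteratedDeriv_gaussian_succ_succ (n : ℕ) (x : ℝ) :
    iteratedDeriv (n + 2) (fun t : ℝ => Real.exp (-t ^ 2)) x =
      -2 * x * iteratedDeriv (n + 1) (fun t : ℝ => Real.exp (-t ^ 2)) x -
        2 * (n + 1) * iteratedDeriv n (fun t : ℝ => Real.exp (-t ^ 2)) x := by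
  have hg : ContDiff ℝ (⊤ : ℕ∞) (fun t : ℝ => Real.exp (-t ^ 2)) := by fun_prop
  have hd (m : ℕ) (y : ℝ) : HasDerivAt (iteratedDeriv m (fun t : ℝ => Real.exp (-t ^ 2)))
      (iteratedDeriv (m + 1) (fun t : ℝ => Real.exp (-t ^ 2)) y) y := by
    rw [iteratedDeriv_succ]
    exact (hg.differentiable_iteratedDeriv m (by exact_mod_cast ENat.natCast_lt_top m) y).hasDerivAt
  have h1 (y : ℝ) : iteratedDeriv 1 (fun t : ℝ => Real.exp (-t ^ 2)) y =
      -2 * y * Real.exp (-y ^ 2) := by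
    rw [iteratedDeriv_one]
    refine HasDerivAt.deriv ?_
    refine ((hasDerivAt_pow 2 y).fun_neg.exp).congr_deriv ?_
    simp; ring
  induction n generalizing x with
  | zero =>
    refine (hd 1 x).unique ?_
    rw [show iteratedDeriv 1 (fun t : ℝ => Real.exp (-t ^ 2)) =
      fun y => -2 * y * Real.exp (-y ^ 2) from funext h1]
    refine (((hasDerivAt_id' x).const_mul (-2)).fun_mul
      ((hasDerivAt_pow 2 x).fun_neg.exp)).congr_deriv ?_
    simp only [iteratedDeriv_zero]
    simp; ring
  | succ n ih =>
    refine (hd (n + 2) x).unique ?_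
    rw [show iteratedDeriv (n + 2) (fun t : ℝ => Real.exp (-t ^ 2)) = _ from funext ih]
    refine ((((hasDerivAt_id' x).const_mul (-2)).fun_mul (hd (n + 1) x)).fun_sub
      ((hd n x).const_mul (2 * ((n : ℝ) + 1)))).congr_deriv ?_
    simp only [show n + 1 + 1 = n + 2 from rfl, ih]
    push_cast; ring

theorem hasDerivAt_hermiteH' (n : ℕ) (x : ℝ) :
    HasDerivAt (hermiteH n) (2 * x * hermiteH n x - hermiteH (n + 1) x) x := by
  have hg : ContDiff ℝ (⊤ : ℕ∞) (fun t : ℝ => Real.exp (-t ^ 2)) := by fun_prop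
  have hd : HasDerivAt (iteratedDeriv n (fun t : ℝ => Real.exp (-t ^ 2)))
      (iteratedDeriv (n + 1) (fun t : ℝ => Real.exp (-t ^ 2)) x) x := by
    rw [iteratedDeriv_succ]
    exact (hg.differentiable_iteratedDeriv n (by exact_mod_cast ENat.natCast_lt_top n) x).hasDerivAt
  refine ((((hasDerivAt_pow 2 x).exp).const_mul ((-1) ^ n)).fun_mul hd).congr_deriv ?_
  simp only [hermiteH, pow_succ]
  simp; ring

theorem hermiteH_succ_succ (n : ℕ) (x : ℝ) :
    hermiteH (n + 2) x = 2 * x * hermiteH (n + 1) x - 2 * (n + 1) * hermiteH n x := by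
  simp only [hermiteH, iteratedDeriv_gaussian_succ_succ]
  ring

theorem hasDerivAt_hermiteH_succ (n : ℕ) (x : ℝ) :
    HasDerivAt (hermiteH (n + 1)) (2 * (n + 1) * hermiteH n x) x := by
  convert hasDerivAt_hermiteH' (n + 1) x using 1
  rw [hermiteH_succ_succ]; ring

@[simp] theorem hermiteH_zero (x : ℝ) : hermiteH 0 x = 1 := by
  simp [hermiteH, ← Real.exp_add]

@[simp] theorem hermiteH_one (x : ℝ) : hermiteH 1 x = 2 * x := by
  have h := (hasDerivAt_hermiteH' 0 x).unique
    ((hasDerivAt_const x (1 : ℝ)).congr_of_eventuallyEq (by filter_upwards with y; simp))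
  simp at h
  linarith

@[fun_prop]
theorem continuous_hermiteH (n : ℕ) : Continuous (hermiteH n) :=
  continuous_iff_continuousAt.2 fun x => (hasDerivAt_hermiteH' n x).continuousAt

theorem abs_pow_mul_exp_neg_sq_le (j : ℕ) (t : ℝ) :
    |t| ^ j * Real.exp (-t ^ 2) ≤ √(j.factorial / 2 ^ j) := by
  apply Real.le_sqrt_of_sq_le
  have h := Real.pow_div_factorial_le_exp (2 * t ^ 2) (by positivity) j
  rw [div_le_iff₀ (by positivity)] at h
  rw [le_div_iff₀ (by positivity), mul_pow, ← pow_mul, mul_comm j 2, pow_mul, sq_abs,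
    ← Real.exp_nat_mul]
  calc (t ^ 2) ^ j * Real.exp ((2 : ℕ) * -t ^ 2) * 2 ^ j
      = (2 * t ^ 2) ^ j * Real.exp (-(2 * t ^ 2)) := by rw [mul_pow]; push_cast; ring_nf
    _ ≤ Real.exp (2 * t ^ 2) * j.factorial * Real.exp (-(2 * t ^ 2)) := by gcongr
    _ = j.factorial := by
      rw [mul_right_comm, ← Real.exp_add]; simp

theorem sqrt_factorial_div_add_two_le (j : ℕ) :
    √((j + 2).factorial / 2 ^ (j + 2)) ≤ (j + 1) * √(j.factorial / 2 ^ j) := by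
  apply Real.sqrt_le_iff.2 ⟨by positivity, ?_⟩
  rw [mul_pow, Real.sq_sqrt (by positivity), Nat.factorial_succ, Nat.factorial_succ]
  push_cast
  rw [show ((j : ℝ) + 1 + 1) * ((j + 1) * j.factorial) / 2 ^ (j + 2) =
    ((j + 2) * (j + 1) / 4) * (j.factorial / 2 ^ j) by field_simp; ring]
  gcongr
  nlinarith [(Nat.cast_nonneg j : (0 : ℝ) ≤ j)]

theorem abs_pow_mul_exp_neg_sq_le_inv (j : ℕ) (s : ℝ) :
    |π * s| ^ j * Real.exp (-(π * s) ^ 2) ≤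
      (j + 2) * √(j.factorial / 2 ^ j) * (1 + s ^ 2)⁻¹ := by
  rw [← div_eq_mul_inv, le_div_iff₀ (by positivity)]
  have h1 := abs_pow_mul_exp_neg_sq_le j (π * s)
  have h2 := (abs_pow_mul_exp_neg_sq_le (j + 2) (π * s)).trans (sqrt_factorial_div_add_two_le j)
  rw [pow_add, sq_abs] at h2
  have h3 : s ^ 2 ≤ (π * s) ^ 2 := by
    rw [mul_pow]
    exact le_mul_of_one_le_left (sq_nonneg s) (by nlinarith [Real.pi_gt_three])
  calc |π * s| ^ j * Real.exp (-(π * s) ^ 2) * (1 + s ^ 2)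
      ≤ |π * s| ^ j * Real.exp (-(π * s) ^ 2) * (1 + (π * s) ^ 2) := by gcongr
    _ ≤ _ := by linarith

theorem integrable_abs_pow_mul_exp_neg_sq (j : ℕ) :
    Integrable fun s : ℝ => |π * s| ^ j * Real.exp (-(π * s) ^ 2) := by
  refine (integrable_inv_one_add_sq.const_mul ((j + 2) * √(j.factorial / 2 ^ j))).mono'
    (by fun_prop) ?_
  filter_upwards with s
  rw [Real.norm_of_nonneg (by positivity)]
  exact abs_pow_mul_exp_neg_sq_le_inv j s

theorem integral_abs_pow_mul_exp_neg_sq_le (j : ℕ) :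
    ∫ s : ℝ, |π * s| ^ j * Real.exp (-(π * s) ^ 2) ≤
      π * ((j + 2) * √(j.factorial / 2 ^ j)) := by
  refine (integral_mono (integrable_abs_pow_mul_exp_neg_sq j)
    (integrable_inv_one_add_sq.const_mul _) (abs_pow_mul_exp_neg_sq_le_inv j)).trans_eq ?_
  rw [integral_const_mul, integral_univ_inv_one_add_sq, mul_comm]

theorem iteratedDeriv_ofReal_eq {g : ℝ → ℝ} {G : ℂ → ℂ} (hg : ContDiff ℝ (⊤ : ℕ∞) g)
    (hG : ContDiff ℂ (⊤ : ℕ∞) G) (h : ∀ x : ℝ, G x = g x) (n : ℕ) (x : ℝ) :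
    iteratedDeriv n G x = iteratedDeriv n g x := by
  induction n generalizing x with
  | zero => simpa using h x
  | succ n ih =>
    have h1 := (hG.differentiable_iteratedDeriv n
      (by exact_mod_cast ENat.natCast_lt_top n) x).hasDerivAt.comp_ofReal
    have h2 := (hg.differentiable_iteratedDeriv n
      (by exact_mod_cast ENat.natCast_lt_top n) x).hasDerivAt.ofReal_comp
    rw [iteratedDeriv_succ, iteratedDeriv_succ]
    exact h1.unique (h2.congr_of_eventuallyEq (by filter_upwards with y using ih y))

theorem hasSum_hermiteH_generating (x : ℝ) (w : ℂ) :
    HasSum (fun n : ℕ => w ^ n / n.factorial * hermiteH n x) (Complex.exp (2 * x * w - w ^ 2)) := by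
  have hG : ContDiff ℂ (⊤ : ℕ∞) (fun z : ℂ => Complex.exp (-z ^ 2)) := by fun_prop
  have h := Complex.hasSum_taylorSeries_of_entire (hG.differentiable (by simp)) x (x - w)
  have h' := h.mul_left (Complex.exp (x ^ 2))
  rw [← Complex.exp_add] at h'
  rw [show (x : ℂ) ^ 2 + -(x - w) ^ 2 = 2 * x * w - w ^ 2 by ring] at h'
  have e (n : ℕ) : w ^ n / n.factorial * hermiteH n x = Complex.exp (x ^ 2) *
      ((n.factorial : ℂ)⁻¹ • (x - w - x) ^ n •
        iteratedDeriv n (fun z : ℂ => Complex.exp (-z ^ 2)) x) := by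
    rw [iteratedDeriv_ofReal_eq (g := fun t : ℝ => Real.exp (-t ^ 2)) (by fun_prop) hG (by simp)]
    simp only [hermiteH, smul_eq_mul]
    push_cast
    rw [show (x : ℂ) - w - x = (-1) * w by ring, mul_pow]
    ring
  simpa only [e] using h'

theorem iteratedDeriv_ofReal_comp {g : ℝ → ℝ} (hg : ContDiff ℝ (⊤ : ℕ∞) g) (n : ℕ) (x : ℝ) :
    iteratedDeriv n (fun t => (g t : ℂ)) x = ((iteratedDeriv n g x : ℝ) : ℂ) := by
  induction n generalizing x with
  | zero => simp
  | succ n ih =>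
    rw [iteratedDeriv_succ, iteratedDeriv_succ, funext ih]
    exact (hg.differentiable_iteratedDeriv n
      (by exact_mod_cast ENat.natCast_lt_top n) x).hasDerivAt.ofReal_comp.deriv

theorem hermiteH_eq_integral (n : ℕ) (x : ℝ) :
    (hermiteH n x : ℂ) = Complex.exp (x ^ 2) * (√π * ∫ s : ℝ,
      (2 * π * Complex.I * s) ^ n * Complex.exp (-(π * s) ^ 2) *
        Complex.exp ((-2 * π * s * x : ℝ) * Complex.I)) := by
  have hf := fourier_gaussian_pi (b := (π : ℂ)) (by simpa using Real.pi_pos)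
  have hint (m : ℕ) : Integrable fun s : ℝ => s ^ m • Complex.exp (-π * π * s ^ 2) := by
    refine ((integrable_abs_pow_mul_exp_neg_sq m).const_mul (π ^ m)⁻¹).mono' (by fun_prop) ?_
    filter_upwards with s
    have : (-π * π * s ^ 2 : ℂ) = (-(π * s) ^ 2 : ℝ) := by push_cast; ring
    rw [norm_smul, this, Complex.norm_exp_ofReal, norm_pow, abs_mul, mul_pow |π|,
      abs_of_pos pi_pos, Real.norm_eq_abs, mul_assoc, inv_mul_cancel_left₀ (by positivity)]
  have hder := Real.iteratedDeriv_fourier (N := ⊤) (n := n) (fun m _ => hint m) le_top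
  have hsq : (π : ℂ) ^ (1 / 2 : ℂ) = (√π : ℝ) := by
    rw [Real.sqrt_eq_rpow, Complex.ofReal_cpow pi_pos.le]; norm_num
  have hpi : (√π : ℂ) ≠ 0 := by
    exact_mod_cast (Real.sqrt_pos.2 pi_pos).ne'
  have hpi' : (π : ℂ) ≠ 0 := by exact_mod_cast pi_ne_zero
  have hg : (FourierTransform.fourier fun s : ℝ => Complex.exp (-π * π * s ^ 2)) =
      fun t : ℝ => (((√π)⁻¹ * Real.exp (-t ^ 2) : ℝ) : ℂ) := by
    rw [hf, hsq]
    funext t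
    push_cast
    rw [neg_div, div_self hpi']
    simp
  have hder' := congrFun hder x
  rw [hg, iteratedDeriv_ofReal_comp (by fun_prop), iteratedDeriv_const_mul_field,
    Real.fourier_real_eq_integral_exp_smul] at hder'
  have hs : ((√π : ℝ) : ℂ) * ((((√π)⁻¹ * iteratedDeriv n (fun t : ℝ => Real.exp (-t ^ 2)) x : ℝ)) : ℂ) =
      ((iteratedDeriv n (fun t : ℝ => Real.exp (-t ^ 2)) x : ℝ) : ℂ) := by
    push_cast
    rw [mul_inv_cancel_left₀ hpi]
  have hI : ∫ s : ℝ, (2 * π * Complex.I * s) ^ n * Complex.exp (-(π * s) ^ 2) *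
        Complex.exp ((-2 * π * s * x : ℝ) * Complex.I) =
      (-1) ^ n * ∫ s : ℝ, Complex.exp ((-2 * π * s * x : ℝ) * Complex.I) •
        (-2 * π * Complex.I * s) ^ n • Complex.exp (-π * π * s ^ 2) := by
    rw [← integral_const_mul]
    congr 1
    funext s
    rw [show (2 * π * Complex.I * s : ℂ) = (-1) * (-2 * π * Complex.I * s) by ring, mul_pow (-1),
      show (-(π * s) ^ 2 : ℂ) = -π * π * s ^ 2 by ring, smul_eq_mul, smul_eq_mul]
    ring
  rw [hI, hermiteH, Complex.ofReal_mul, ← hs, hder']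
  push_cast
  ring

theorem abs_hermiteH_le (n : ℕ) (x : ℝ) :
    |hermiteH n x| ≤
      √π * π * 2 ^ n * ((n + 2) * √(n.factorial / 2 ^ n)) * Real.exp (x ^ 2) := by
  have h := congrArg norm (hermiteH_eq_integral n x)
  have h2 : ‖∫ s : ℝ, (2 * π * Complex.I * s) ^ n * Complex.exp (-(π * s) ^ 2) *
      Complex.exp ((-2 * π * s * x : ℝ) * Complex.I)‖ ≤
      2 ^ n * (π * ((n + 2) * √(n.factorial / 2 ^ n))) := by
    refine (norm_integral_le_integral_norm _).trans ?_
    refine le_trans (le_of_eq ?_)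
      (mul_le_mul_of_nonneg_left (integral_abs_pow_mul_exp_neg_sq_le n) (by positivity))
    rw [← integral_const_mul]
    congr 1
    funext s
    rw [norm_mul, norm_mul, Complex.norm_exp_ofReal_mul_I, mul_one,
      show (-(π * s) ^ 2 : ℂ) = (-(π * s) ^ 2 : ℝ) by push_cast; ring, Complex.norm_exp_ofReal,
      norm_pow, ← mul_assoc, ← mul_pow]
    simp [abs_mul, abs_of_pos pi_pos, mul_assoc]
  rw [Complex.norm_real, Real.norm_eq_abs, norm_mul, norm_mul, Complex.norm_real,
    Real.norm_of_nonneg (Real.sqrt_nonneg _), show (x : ℂ) ^ 2 = (x ^ 2 : ℝ) by push_cast; ring,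
    Complex.norm_exp_ofReal] at h
  rw [h]
  calc _ ≤ Real.exp (x ^ 2) * (√π * (2 ^ n * (π * ((n + 2) * √(n.factorial / 2 ^ n))))) := by gcongr
    _ = _ := by ring

theorem exists_abs_hermiteH_le (n : ℕ) : ∃ C : ℝ, ∀ x, |hermiteH n x| ≤ C * Real.exp (x ^ 2) :=
  ⟨_, abs_hermiteH_le n⟩

theorem integrable_mul_of_hasCompactSupport {g F : ℝ → ℝ} (hg : Continuous g) (hF : Continuous F)
    (hs : HasCompactSupport F) : Integrable fun x => g x * F x :=
  (hg.mul hF).integrable_of_hasCompactSupport hs.mul_left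

theorem exists_abs_integral_hermiteH_mul_le {F : ℝ → ℝ} (hF : Continuous F)
    (hs : HasCompactSupport F) : ∃ C : ℝ, 0 ≤ C ∧ ∀ n : ℕ,
      ∫ x, |hermiteH n x * F x| ≤ C * (2 ^ n * ((n + 2) * √(n.factorial / 2 ^ n))) := by
  refine ⟨√π * π * ∫ x, Real.exp (x ^ 2) * |F x|, by positivity, fun n => ?_⟩
  have hE : Integrable fun x => Real.exp (x ^ 2) * |F x| :=
    integrable_mul_of_hasCompactSupport (by fun_prop) hF.abs hs.abs
  refine (integral_mono (g := fun x => (√π * π * 2 ^ n * ((n + 2) * √(n.factorial / 2 ^ n))) *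
    (Real.exp (x ^ 2) * |F x|))
    (integrable_mul_of_hasCompactSupport (by fun_prop) hF hs).abs (hE.const_mul _)
    fun x => ?_).trans_eq ?_
  · simp only [abs_mul, ← mul_assoc]
    gcongr
    simpa only [← mul_assoc] using abs_hermiteH_le n x
  · rw [integral_const_mul]; ring

theorem integral_hermiteH_mul_eq {F : ℝ → ℝ} (hF : ContDiff ℝ 1 F)
    (hs : HasCompactSupport F) (n : ℕ) :
    ∫ x, hermiteH n x * F x = -(2 * (n + 1) : ℝ)⁻¹ * ∫ x, hermiteH (n + 1) x * deriv F x := by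
  have hc : Continuous (deriv F) := hF.continuous_deriv le_rfl
  have h := integral_mul_deriv_eq_deriv_mul_of_integrable
    (u := hermiteH (n + 1)) (v := F) (u' := fun x => 2 * (n + 1) * hermiteH n x) (v' := deriv F)
    (fun x _ => hasDerivAt_hermiteH_succ n x)
    (fun x _ => (hF.differentiable one_ne_zero x).hasDerivAt)
    (integrable_mul_of_hasCompactSupport (by fun_prop) hc hs.deriv)
    (integrable_mul_of_hasCompactSupport (by fun_prop) hF.continuous hs)
    (integrable_mul_of_hasCompactSupport (by fun_prop) hF.continuous hs)
  simp only [mul_assoc] at h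
  rw [h, integral_const_mul, integral_const_mul]
  field_simp

theorem abs_integral_hermiteH_mul_le (k : ℕ) : ∀ {F : ℝ → ℝ}, ContDiff ℝ (⊤ : ℕ∞) F →
    HasCompactSupport F → ∃ C : ℝ, 0 ≤ C ∧ ∀ n : ℕ, (n + 1 : ℝ) ^ k * |∫ x, hermiteH n x * F x| ≤
      C * (2 ^ (n + k) * ((n + k + 2) * √((n + k).factorial / 2 ^ (n + k)))) := by
  induction k with
  | zero =>
    intro F hF hs
    obtain ⟨C, hC, h⟩ := exists_abs_integral_hermiteH_mul_le hF.continuous hs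
    refine ⟨C, hC, fun n => ?_⟩
    simpa using abs_integral_le_integral_abs.trans (h n)
  | succ k ih =>
    intro F hF hs
    obtain ⟨C, hC, h⟩ := ih (F := deriv F) ((contDiff_infty_iff_deriv.1 hF).2) hs.deriv
    refine ⟨C, hC, fun n => ?_⟩
    have h1 := h (n + 1)
    rw [show n + 1 + k = n + (k + 1) by ring] at h1
    push_cast at h1 ⊢
    rw [show (n : ℝ) + 1 + k + 2 = n + (k + 1) + 2 by ring] at h1
    rw [integral_hermiteH_mul_eq (hF.of_le (by exact_mod_cast le_top)) hs, abs_mul, abs_neg,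
      abs_inv, abs_of_pos (by positivity : (0 : ℝ) < 2 * (n + 1))]
    refine le_trans ?_ h1
    calc (n + 1 : ℝ) ^ (k + 1) * ((2 * (n + 1) : ℝ)⁻¹ * |∫ x, hermiteH (n + 1) x * deriv F x|)
        = 2⁻¹ * ((n + 1 : ℝ) ^ k * |∫ x, hermiteH (n + 1) x * deriv F x|) := by
          field_simp
          ring
      _ ≤ 1 * ((n + 1 + 1 : ℝ) ^ k * |∫ x, hermiteH (n + 1) x * deriv F x|) := by
          gcongr <;> linarith
      _ = _ := one_mul _

theorem sqrt_factorial_add_eight_le (n : ℕ) :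
    √((n + 8).factorial / 2 ^ (n + 8)) ≤ 256 * (n + 1) ^ 4 * √(n.factorial / 2 ^ n) := by
  apply Real.sqrt_le_iff.2 ⟨by positivity, ?_⟩
  have h : (n + 8).factorial ≤ n.factorial * (8 * (n + 1)) ^ 8 := by
    rw [← Nat.factorial_mul_ascFactorial]
    gcongr
    exact (Nat.ascFactorial_le_pow_add n 8).trans (by gcongr; omega)
  have h' : ((n + 8).factorial : ℝ) ≤ n.factorial * (8 * (n + 1)) ^ 8 := by exact_mod_cast h
  rw [mul_pow, Real.sq_sqrt (by positivity)]
  calc ((n + 8).factorial : ℝ) / 2 ^ (n + 8)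
      ≤ n.factorial * (8 * (n + 1)) ^ 8 / 2 ^ (n + 8) := by gcongr
    _ = _ := by rw [pow_add]; field_simp; ring

theorem exists_abs_hermite_coeff_mul_moment_le {F : ℝ → ℝ} (hF : ContDiff ℝ (⊤ : ℕ∞) F)
    (hs : HasCompactSupport F) : ∃ C : ℝ, ∀ n : ℕ,
      |∫ x, hermiteH n x * F x| / n.factorial * (π * ((n + 2) * √(n.factorial / 2 ^ n))) ≤
        C * ((n + 1 : ℝ) ^ 2)⁻¹ := by
  obtain ⟨C, hC, h⟩ := abs_integral_hermiteH_mul_le 8 hF hs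
  refine ⟨C * π * (2 ^ 8 * 20 * 256), fun n => ?_⟩
  have hq : √(n.factorial / 2 ^ n : ℝ) * √(n.factorial / 2 ^ n) = n.factorial / 2 ^ n :=
    Real.mul_self_sqrt (by positivity)
  have hn : (0 : ℝ) ≤ n := n.cast_nonneg
  rw [← div_eq_mul_inv, le_div_iff₀ (by positivity)]
  refine le_of_mul_le_mul_right (a := (n + 1 : ℝ) ^ 6) ?_ (by positivity)
  calc |∫ x, hermiteH n x * F x| / n.factorial * (π * ((n + 2) * √(n.factorial / 2 ^ n))) *
        (n + 1) ^ 2 * (n + 1) ^ 6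
      = ((n + 1) ^ 8 * |∫ x, hermiteH n x * F x|) *
          (π * ((n + 2) * √(n.factorial / 2 ^ n))) / n.factorial := by ring
    _ ≤ (C * (2 ^ (n + 8) * ((n + (8 : ℕ) + 2) * √((n + 8).factorial / 2 ^ (n + 8))))) *
          (π * ((n + 2) * √(n.factorial / 2 ^ n))) / n.factorial := by
        gcongr ?_ * _ / _
        exact h n
    _ ≤ (C * (2 ^ (n + 8) * ((10 * (n + 1)) * (256 * (n + 1) ^ 4 * √(n.factorial / 2 ^ n))))) *
          (π * ((2 * (n + 1)) * √(n.factorial / 2 ^ n))) / n.factorial := by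
        gcongr
        · push_cast; linarith
        · exact sqrt_factorial_add_eight_le n
        · linarith
    _ = C * 2 ^ (n + 8) * 10 * 256 * 2 * π * (n + 1) ^ 6 *
          (√(n.factorial / 2 ^ n : ℝ) * √(n.factorial / 2 ^ n)) / n.factorial := by ring
    _ = C * π * (2 ^ 8 * 20 * 256) * (n + 1) ^ 6 := by
        rw [hq, pow_add]
        field_simp
        ring

theorem summable_inv_add_one_sq : Summable fun n : ℕ => ((n + 1 : ℝ) ^ 2)⁻¹ := by
  have := (summable_nat_add_iff 1).2 (Real.summable_nat_pow_inv.2 one_lt_two)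
  simpa using this

theorem sqrt_mul_pow_le (n : ℕ) (w : ℝ) :
    w ^ n / n.factorial * (2 ^ n * √(n.factorial / 2 ^ n)) ≤
      Real.exp (4 * w ^ 2) * (1 / 2) ^ n := by
  have h : √(n.factorial / 2 ^ n : ℝ) * √(n.factorial / 2 ^ n) = n.factorial / 2 ^ n :=
    Real.mul_self_sqrt (by positivity)
  apply abs_le_of_sq_le_sq' _ (by positivity) |>.2
  have h1 := Real.pow_div_factorial_le_exp (8 * w ^ 2) (by positivity) n
  calc (w ^ n / n.factorial * (2 ^ n * √(n.factorial / 2 ^ n))) ^ 2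
      = (w ^ n / n.factorial * 2 ^ n) ^ 2 *
        (√(n.factorial / 2 ^ n : ℝ) * √(n.factorial / 2 ^ n)) := by ring
    _ = ((8 * w ^ 2) ^ n / n.factorial) * ((1 / 2) ^ n) ^ 2 := by
        rw [h, mul_pow 8, show (8 : ℝ) = 2 * 2 * 2 by norm_num, mul_pow (2 * 2 : ℝ), mul_pow (2 : ℝ),
          one_div, inv_pow, ← pow_mul w, mul_comm 2 n, pow_mul w]
        field_simp
    _ ≤ Real.exp (8 * w ^ 2) * ((1 / 2) ^ n) ^ 2 := by gcongr
    _ = _ := by rw [mul_pow, ← Real.exp_nat_mul]; push_cast; ring_nf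

theorem hasSum_integral_hermiteH_generating {F : ℝ → ℝ} (hF : Continuous F)
    (hs : HasCompactSupport F) (w : ℂ) :
    HasSum (fun n : ℕ => w ^ n / n.factorial * ((∫ x, hermiteH n x * F x : ℝ) : ℂ))
      (∫ x : ℝ, Complex.exp (2 * x * w - w ^ 2) * (F x : ℂ)) := by
  obtain ⟨C, hC, hb⟩ := exists_abs_integral_hermiteH_mul_le hF hs
  have hi (n : ℕ) : Integrable fun x => hermiteH n x * F x :=
    integrable_mul_of_hasCompactSupport (by fun_prop) hF hs
  have key := hasSum_integral_of_summable_integral_norm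
    (F := fun (n : ℕ) (x : ℝ) => w ^ n / n.factorial * ((hermiteH n x * F x : ℝ) : ℂ)) (μ := volume)
    (fun n => (hi n).ofReal.const_mul _) ?_
  · have e1 (n : ℕ) : ∫ x, w ^ n / n.factorial * ((hermiteH n x * F x : ℝ) : ℂ) =
        w ^ n / n.factorial * ((∫ x, hermiteH n x * F x : ℝ) : ℂ) := by
      rw [integral_const_mul, integral_complex_ofReal]
    have e2 (x : ℝ) : ∑' n : ℕ, w ^ n / n.factorial * ((hermiteH n x * F x : ℝ) : ℂ) =
        Complex.exp (2 * x * w - w ^ 2) * (F x : ℂ) := by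
      rw [← ((hasSum_hermiteH_generating x w).mul_right (F x : ℂ)).tsum_eq]
      congr 1
      funext n
      push_cast
      ring
    simpa only [e1, e2] using key
  · have hsum : Summable fun n : ℕ => C * Real.exp (4 * ‖w‖ ^ 2) * ((n + 2) * (1 / 2 : ℝ) ^ n) := by
      apply Summable.mul_left
      simp only [add_mul]
      refine Summable.add ?_ ((summable_geometric_of_lt_one (by norm_num) (by norm_num)).mul_left _)
      simpa using summable_pow_mul_geometric_of_norm_lt_one 1 (r := (1 / 2 : ℝ)) (by norm_num)
    refine Summable.of_nonneg_of_le (fun n => by positivity) (fun n => ?_) hsum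
    simp only [norm_mul (_ / _), norm_div, norm_pow, Complex.norm_natCast, Complex.norm_real]
    rw [integral_const_mul]
    simp only [Real.norm_eq_abs]
    calc ‖w‖ ^ n / n.factorial * ∫ x, |hermiteH n x * F x|
        ≤ ‖w‖ ^ n / n.factorial * (C * (2 ^ n * ((n + 2) * √(n.factorial / 2 ^ n)))) := by
          gcongr; exact hb n
      _ = (C * (n + 2)) * (‖w‖ ^ n / n.factorial * (2 ^ n * √(n.factorial / 2 ^ n))) := by ring
      _ ≤ C * (n + 2) * (Real.exp (4 * ‖w‖ ^ 2) * (1 / 2) ^ n) :=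
          mul_le_mul_of_nonneg_left (sqrt_mul_pow_le n ‖w‖) (by positivity)
      _ = _ := by ring

/-- The Hermite expansion of a smooth compactly supported function, at every point. -/
theorem hasSum_hermiteH_expansion {F : ℝ → ℝ} (hF : ContDiff ℝ (⊤ : ℕ∞) F)
    (hs : HasCompactSupport F) (y : ℝ) :
    HasSum (fun n : ℕ => hermiteH n y / (2 ^ n * n.factorial) * ∫ x, hermiteH n x * F x)
      (√π * Real.exp (y ^ 2) * F y) := by
  set φ : ℕ → ℝ → ℂ := fun n s => (π * Complex.I * s) ^ n / n.factorial *
    ((∫ x, hermiteH n x * F x : ℝ) : ℂ) * Complex.exp (-(π * s) ^ 2) *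
      Complex.exp ((-2 * π * s * y : ℝ) * Complex.I) with hφ
  have hnorm (n : ℕ) (s : ℝ) : ‖φ n s‖ = |∫ x, hermiteH n x * F x| / n.factorial *
      (|π * s| ^ n * Real.exp (-(π * s) ^ 2)) := by
    rw [hφ]
    simp only [norm_mul, Complex.norm_exp_ofReal_mul_I, mul_one]
    rw [show (-(π * s) ^ 2 : ℂ) = (-(π * s) ^ 2 : ℝ) by push_cast; ring, Complex.norm_exp_ofReal]
    simp only [norm_div, norm_pow, norm_mul, Complex.norm_I, Complex.norm_real,
      Complex.norm_natCast, Real.norm_eq_abs, abs_mul]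
    ring
  have hint (n : ℕ) : Integrable (φ n) := by
    refine ((integrable_abs_pow_mul_exp_neg_sq n).const_mul
      (|∫ x, hermiteH n x * F x| / n.factorial)).mono' (by fun_prop) ?_
    filter_upwards with s using (hnorm n s).le
  obtain ⟨C, hC⟩ := exists_abs_hermite_coeff_mul_moment_le hF hs
  have hsum : Summable fun n => ∫ s, ‖φ n s‖ := by
    refine Summable.of_nonneg_of_le (fun n => by positivity) (fun n => ?_)
      (summable_inv_add_one_sq.mul_left C)
    simp only [hnorm]
    rw [integral_const_mul]
    exact (mul_le_mul_of_nonneg_left (integral_abs_pow_mul_exp_neg_sq_le n)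
      (by positivity)).trans (hC n)
  have key := hasSum_integral_of_summable_integral_norm hint hsum
  let S : SchwartzMap ℝ ℂ := HasCompactSupport.toSchwartzMap (f := fun x => (F x : ℂ))
    (hs.comp_left (g := fun r : ℝ => (r : ℂ)) rfl) (Complex.ofRealCLM.contDiff.comp hF)
  have htsum (s : ℝ) : ∑' n, φ n s = Complex.exp ((-2 * π * s * y : ℝ) * Complex.I) •
      FourierTransformInv.fourierInv (fun x => (F x : ℂ)) s := by
    have h := ((hasSum_integral_hermiteH_generating hF.continuous hs (π * Complex.I * s)).mul_right
      (Complex.exp (-(π * s) ^ 2))).mul_right (Complex.exp ((-2 * π * s * y : ℝ) * Complex.I))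
    rw [h.tsum_eq, Real.fourierInv_eq', ← integral_mul_const, ← integral_mul_const,
      ← integral_smul]
    congr 1
    funext x
    rw [smul_eq_mul, smul_eq_mul, mul_right_comm (Complex.exp _) (F x : ℂ), ← Complex.exp_add]
    have : 2 * x * (π * Complex.I * s) - (π * Complex.I * s) ^ 2 + -(π * s) ^ 2 =
        ((2 * π * inner ℝ x s : ℝ) : ℂ) * Complex.I := by
      rw [mul_pow, mul_pow, Complex.I_sq]
      simp
      ring
    rw [this]
    ring
  simp only [htsum] at key
  rw [← Real.fourier_real_eq_integral_exp_smul] at key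
  have hinv : FourierTransform.fourier (FourierTransformInv.fourierInv (fun x => (F x : ℂ))) =
      fun x => (F x : ℂ) := by
    change FourierTransform.fourier (FourierTransformInv.fourierInv (S : ℝ → ℂ)) = S
    rw [← SchwartzMap.fourierInv_coe, ← SchwartzMap.fourier_coe,
      FourierTransform.fourier_fourierInv_eq]
  rw [hinv] at key
  have key2 := key.mul_left (Complex.exp (y ^ 2) * √π)
  have hterm (n : ℕ) : Complex.exp (y ^ 2) * √π * ∫ s, φ n s =
      ((hermiteH n y / (2 ^ n * n.factorial) * ∫ x, hermiteH n x * F x : ℝ) : ℂ) := by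
    have hφn : φ n = fun s : ℝ => (((∫ x, hermiteH n x * F x : ℝ) : ℂ) / (2 ^ n * n.factorial)) *
        ((2 * π * Complex.I * s) ^ n * Complex.exp (-(π * s) ^ 2) *
          Complex.exp ((-2 * π * s * y : ℝ) * Complex.I)) := by
      funext s
      rw [hφ, show (2 * π * Complex.I * s : ℂ) = 2 * (π * Complex.I * s) by ring, mul_pow 2]
      field_simp
    rw [hφn, integral_const_mul, Complex.ofReal_mul, Complex.ofReal_div, hermiteH_eq_integral]
    push_cast
    ring
  have hval : Complex.exp (y ^ 2) * √π * (F y : ℂ) =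
      ((√π * Real.exp (y ^ 2) * F y : ℝ) : ℂ) := by push_cast; ring
  simp only [hterm, hval] at key2
  exact Complex.hasSum_ofReal.1 key2

theorem sq_div_le_of_add {a b : ℝ} (ha : 0 < a) (hb : 0 < b) (x y : ℝ) :
    (x + y) ^ 2 / (a + b) ≤ x ^ 2 / a + y ^ 2 / b := by
  rw [div_add_div _ _ ha.ne' hb.ne', div_le_div_iff₀ (by positivity) (by positivity)]
  nlinarith [sq_nonneg (b * x - a * y)]

theorem exists_abs_hermiteH_mul_heatKernel_le {τ β : ℝ} (hτ : 0 < τ) (hβ : 0 < β) (n : ℕ) :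
    ∃ C δ : ℝ, 0 < δ ∧ ∀ ξ η : ℝ,
      |hermiteH n (ξ / (2 * √(τ + β))) * Real.exp (-(ξ - η) ^ 2 / (4 * τ))| ≤
        C * Real.exp (-δ * ξ ^ 2) * Real.exp (η ^ 2 / (2 * β)) := by
  obtain ⟨C, hC⟩ := exists_abs_hermiteH_le n
  have hC0 : 0 ≤ C := by
    have := (abs_nonneg _).trans (hC 0)
    simpa using this
  refine ⟨C, 1 / (4 * τ + 2 * β) - 1 / (4 * (τ + β)), ?_, fun ξ η => ?_⟩
  · rw [sub_pos]
    exact one_div_lt_one_div_of_lt (by positivity) (by linarith)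
  have h := sq_div_le_of_add (by positivity : 0 < 4 * τ) (by positivity : 0 < 2 * β) (ξ - η) η
  rw [sub_add_cancel] at h
  have hz : (ξ / (2 * √(τ + β))) ^ 2 = ξ ^ 2 / (4 * (τ + β)) := by
    rw [div_pow, mul_pow, Real.sq_sqrt (by positivity)]; norm_num
  rw [abs_mul, Real.abs_exp]
  calc _ ≤ C * Real.exp ((ξ / (2 * √(τ + β))) ^ 2) * Real.exp (-(ξ - η) ^ 2 / (4 * τ)) := by
        gcongr; exact hC _
    _ = C * Real.exp (ξ ^ 2 / (4 * (τ + β)) + -(ξ - η) ^ 2 / (4 * τ)) := by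
        rw [hz, mul_assoc, ← Real.exp_add]
    _ ≤ C * Real.exp (-(1 / (4 * τ + 2 * β) - 1 / (4 * (τ + β))) * ξ ^ 2 + η ^ 2 / (2 * β)) := by
        refine mul_le_mul_of_nonneg_left (Real.exp_le_exp.2 ?_) hC0
        rw [neg_div]
        have : -(1 / (4 * τ + 2 * β) - 1 / (4 * (τ + β))) * ξ ^ 2 =
          ξ ^ 2 / (4 * (τ + β)) - ξ ^ 2 / (4 * τ + 2 * β) := by ring
        linarith
    _ = _ := by rw [Real.exp_add, mul_assoc]

theorem integrable_hermiteH_mul_heatKernel {τ β : ℝ} (hτ : 0 < τ) (hβ : 0 < β) (n : ℕ) (η : ℝ) :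
    Integrable fun ξ : ℝ =>
      hermiteH n (ξ / (2 * √(τ + β))) * Real.exp (-(ξ - η) ^ 2 / (4 * τ)) := by
  obtain ⟨C, δ, hδ, h⟩ := exists_abs_hermiteH_mul_heatKernel_le hτ hβ n
  refine (((integrable_exp_neg_mul_sq hδ).const_mul C).mul_const
    (Real.exp (η ^ 2 / (2 * β)))).mono' (by fun_prop) ?_
  filter_upwards with ξ using h ξ η

theorem integrable_sub_mul_hermiteH_mul_heatKernel {τ β : ℝ} (hτ : 0 < τ) (hβ : 0 < β)
    (n : ℕ) (η : ℝ) :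
    Integrable fun ξ : ℝ => (ξ - η) *
      (hermiteH n (ξ / (2 * √(τ + β))) * Real.exp (-(ξ - η) ^ 2 / (4 * τ))) := by
  have ha : √(τ + β) ≠ 0 := (Real.sqrt_pos.2 (by positivity)).ne'
  have hI (m : ℕ) := integrable_hermiteH_mul_heatKernel hτ hβ m η
  cases n with
  | zero =>
    refine (((hI 1).const_mul √(τ + β)).sub ((hI 0).const_mul η)).congr ?_
    filter_upwards with ξ
    simp only [Pi.sub_apply, hermiteH_one, hermiteH_zero]
    field_simp
  | succ n =>
    refine ((((hI (n + 2)).add ((hI n).const_mul (2 * (n + 1)))).const_mul √(τ + β)).sub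
      ((hI (n + 1)).const_mul η)).congr ?_
    filter_upwards with ξ
    simp only [Pi.sub_apply, Pi.add_apply, hermiteH_succ_succ]
    field_simp
    ring

theorem integral_sub_mul_hermiteH_mul_heatKernel {τ β : ℝ} (hτ : 0 < τ) (hβ : 0 < β)
    (n m : ℕ) (c : ℝ) (hd : ∀ z, HasDerivAt (hermiteH n) (c * hermiteH m z) z) (η : ℝ) :
    ∫ ξ : ℝ, (ξ - η) *
      (hermiteH n (ξ / (2 * √(τ + β))) * Real.exp (-(ξ - η) ^ 2 / (4 * τ))) =
    τ * c / √(τ + β) * ∫ ξ : ℝ,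
      hermiteH m (ξ / (2 * √(τ + β))) * Real.exp (-(ξ - η) ^ 2 / (4 * τ)) := by
  have h := integral_mul_deriv_eq_deriv_mul_of_integrable
    (u := fun ξ => hermiteH n (ξ / (2 * √(τ + β))))
    (u' := fun ξ => c * hermiteH m (ξ / (2 * √(τ + β))) * (1 / (2 * √(τ + β))))
    (v := fun ξ => -2 * τ * Real.exp (-(ξ - η) ^ 2 / (4 * τ)))
    (v' := fun ξ => (ξ - η) * Real.exp (-(ξ - η) ^ 2 / (4 * τ)))
    (fun ξ _ => (hd _).comp ξ ((hasDerivAt_id' ξ).div_const _))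
    (fun ξ _ => ?_) ?_ ?_ ?_
  · rw [← integral_const_mul]
    rw [← integral_neg] at h
    have e₁ (ξ : ℝ) : (ξ - η) *
        (hermiteH n (ξ / (2 * √(τ + β))) * Real.exp (-(ξ - η) ^ 2 / (4 * τ))) =
        hermiteH n (ξ / (2 * √(τ + β))) * ((ξ - η) * Real.exp (-(ξ - η) ^ 2 / (4 * τ))) := by
      ring
    have e₂ (ξ : ℝ) : τ * c / √(τ + β) *
        (hermiteH m (ξ / (2 * √(τ + β))) * Real.exp (-(ξ - η) ^ 2 / (4 * τ))) =
        -(c * hermiteH m (ξ / (2 * √(τ + β))) * (1 / (2 * √(τ + β))) *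
          (-2 * τ * Real.exp (-(ξ - η) ^ 2 / (4 * τ)))) := by
      field_simp
    simp only [e₁, e₂]
    exact h
  · refine (((((hasDerivAt_id' ξ).sub_const η).fun_pow 2).fun_neg.div_const (4 * τ)).exp.const_mul
      (-2 * τ)).congr_deriv ?_
    field_simp
    ring
  · refine (integrable_sub_mul_hermiteH_mul_heatKernel hτ hβ n η).congr ?_
    filter_upwards with ξ
    simp only [Pi.mul_apply]; ring
  · refine ((integrable_hermiteH_mul_heatKernel hτ hβ m η).const_mul
      (c * (1 / (2 * √(τ + β))) * (-2 * τ))).congr ?_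
    filter_upwards with ξ
    simp only [Pi.mul_apply]; ring
  · refine ((integrable_hermiteH_mul_heatKernel hτ hβ n η).const_mul (-2 * τ)).congr ?_
    filter_upwards with ξ
    simp only [Pi.mul_apply]; ring

/-- The heat flow maps dilated Hermite polynomials to dilated Hermite polynomials. -/
theorem integral_hermiteH_mul_heatKernel {τ β : ℝ} (hτ : 0 < τ) (hβ : 0 < β) (n : ℕ) (η : ℝ) :
    ∫ ξ : ℝ, hermiteH n (ξ / (2 * √(τ + β))) * Real.exp (-(ξ - η) ^ 2 / (4 * τ)) =
      2 * √(π * τ) * (√β / √(τ + β)) ^ n * hermiteH n (η / (2 * √β)) := by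
  have ha : √(τ + β) ≠ 0 := (Real.sqrt_pos.2 (by positivity)).ne'
  have ha2 : √(τ + β) ^ 2 = τ + β := Real.sq_sqrt (by positivity)
  have hb : √β ≠ 0 := (Real.sqrt_pos.2 hβ).ne'
  have hb2 : √β ^ 2 = β := Real.sq_sqrt hβ.le
  have hI (m : ℕ) := integrable_hermiteH_mul_heatKernel hτ hβ m η
  have hS (m : ℕ) := integrable_sub_mul_hermiteH_mul_heatKernel hτ hβ m η
  have h0 : ∫ ξ : ℝ, hermiteH 0 (ξ / (2 * √(τ + β))) * Real.exp (-(ξ - η) ^ 2 / (4 * τ)) =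
      2 * √(π * τ) := by
    simp only [hermiteH_zero, one_mul]
    rw [integral_sub_right_eq_self (fun ξ : ℝ => Real.exp (-ξ ^ 2 / (4 * τ))) η]
    have := integral_gaussian (1 / (4 * τ))
    rw [show π / (1 / (4 * τ)) = 2 ^ 2 * (π * τ) by field_simp; norm_num,
      Real.sqrt_mul (by norm_num), Real.sqrt_sq (by norm_num)] at this
    rw [← this]
    congr 1; funext ξ; congr 1; ring
  induction n using Nat.twoStepInduction with
  | zero => simpa using h0
  | one =>
    have hs := integral_sub_mul_hermiteH_mul_heatKernel hτ hβ 0 0 0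
      (fun z => by
        rw [show hermiteH 0 = fun _ => (1 : ℝ) from funext hermiteH_zero]
        simpa using hasDerivAt_const z (1 : ℝ)) η
    have e (ξ : ℝ) : hermiteH 1 (ξ / (2 * √(τ + β))) * Real.exp (-(ξ - η) ^ 2 / (4 * τ)) =
        (√(τ + β))⁻¹ * ((ξ - η) * (hermiteH 0 (ξ / (2 * √(τ + β))) *
          Real.exp (-(ξ - η) ^ 2 / (4 * τ)))) +
        η / √(τ + β) * (hermiteH 0 (ξ / (2 * √(τ + β))) * Real.exp (-(ξ - η) ^ 2 / (4 * τ))) := by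
      simp only [hermiteH_one, hermiteH_zero]
      field_simp
      ring
    simp only [e]
    rw [integral_add ((hS 0).const_mul _) ((hI 0).const_mul _), integral_const_mul,
      integral_const_mul, hs, h0]
    simp only [hermiteH_one]
    field_simp
    ring
  | more n ih0 ih1 =>
    have hs := integral_sub_mul_hermiteH_mul_heatKernel hτ hβ (n + 1) n (2 * (n + 1))
      (hasDerivAt_hermiteH_succ n) η
    have e (ξ : ℝ) : hermiteH (n + 2) (ξ / (2 * √(τ + β))) * Real.exp (-(ξ - η) ^ 2 / (4 * τ)) =
        (√(τ + β))⁻¹ * ((ξ - η) * (hermiteH (n + 1) (ξ / (2 * √(τ + β))) *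
          Real.exp (-(ξ - η) ^ 2 / (4 * τ)))) +
        (η / √(τ + β) * (hermiteH (n + 1) (ξ / (2 * √(τ + β))) *
          Real.exp (-(ξ - η) ^ 2 / (4 * τ))) +
        -(2 * (n + 1)) * (hermiteH n (ξ / (2 * √(τ + β))) * Real.exp (-(ξ - η) ^ 2 / (4 * τ)))) := by
      simp only [hermiteH_succ_succ]
      field_simp
      ring
    simp only [e]
    rw [integral_add ((hS _).const_mul _) (((hI _).const_mul _).fun_add ((hI _).const_mul _)),
      integral_add ((hI _).const_mul _) ((hI _).const_mul _), integral_const_mul,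
      integral_const_mul, integral_const_mul, hs, ih0, ih1, hermiteH_succ_succ]
    have hk : (√(τ + β))⁻¹ * (τ * (2 * (n + 1)) / √(τ + β)) - 2 * (n + 1) =
        -2 * (n + 1) * (√β / √(τ + β)) ^ 2 := by
      rw [div_pow, hb2, ha2]
      field_simp
      rw [ha2]
      ring
    have hη : η / √(τ + β) = √β / √(τ + β) * (2 * (η / (2 * √β))) := by field_simp
    rw [hη]
    linear_combination (2 * √(π * τ) * (√β / √(τ + β)) ^ n * hermiteH n (η / (2 * √β))) * hk

theorem integral_hermiteH_mul_heatFlow {f : ℝ → ℝ} (hf : Continuous f) (hs : HasCompactSupport f)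
    {τ β : ℝ} (hτ : 0 < τ) (hβ : 0 < β) (n : ℕ) :
    ∫ ξ : ℝ, hermiteH n (ξ / (2 * √(τ + β))) *
      (1 / (2 * √(π * τ)) * ∫ η : ℝ, Real.exp (-(ξ - η) ^ 2 / (4 * τ)) * f η) =
    (√β / √(τ + β)) ^ n * ∫ η : ℝ, hermiteH n (η / (2 * √β)) * f η := by
  have hN : √(π * τ) ≠ 0 := (Real.sqrt_pos.2 (by positivity)).ne'
  obtain ⟨C, δ, hδ, h⟩ := exists_abs_hermiteH_mul_heatKernel_le hτ hβ n
  have hint : Integrable (Function.uncurry fun ξ η : ℝ => hermiteH n (ξ / (2 * √(τ + β))) *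
      Real.exp (-(ξ - η) ^ 2 / (4 * τ)) * f η) (volume.prod volume) := by
    refine (((integrable_exp_neg_mul_sq hδ).const_mul C).mul_prod
      (integrable_mul_of_hasCompactSupport (g := fun η : ℝ => Real.exp (η ^ 2 / (2 * β)))
        (by fun_prop) hf.abs hs.abs)).mono' (Continuous.aestronglyMeasurable (by fun_prop)) ?_
    filter_upwards with ⟨ξ, η⟩
    simp only [Function.uncurry_apply_pair, norm_mul (_ * _) (f η), Real.norm_eq_abs]
    rw [← mul_assoc]
    gcongr
    exact h ξ η
  have hswap := integral_integral_swap hint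
  simp only [integral_mul_const, integral_hermiteH_mul_heatKernel hτ hβ] at hswap
  calc _ = 1 / (2 * √(π * τ)) * ∫ ξ : ℝ, ∫ η : ℝ, hermiteH n (ξ / (2 * √(τ + β))) *
      Real.exp (-(ξ - η) ^ 2 / (4 * τ)) * f η := by
        rw [← integral_const_mul]
        congr 1
        funext ξ
        simp only [mul_assoc, integral_const_mul]
        ring
    _ = _ := by
        rw [hswap, ← integral_const_mul, ← integral_const_mul]
        congr 1
        funext η
        field_simp

/-- First Hermite-series reconstruction formula for the inverse Cauchy problem of
the heat equation: if `u(τ,·)` is the temperature field at time `τ` obtained from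
a smooth, compactly supported initial field `f`, then for every `x` the series
`(e^{−x²/(4β)}/(2√(πβ))) ∑_j (1/(2√β))^j H_j(x/(2√β)) ((τ+β)^{j/2}/j!) u_j`
converges, with `u_j = ∫ H_j(ξ/(2√(τ+β))) u(τ,ξ) dξ`, and its sum is `f(x)`. -/
theorem inverse_heat_hermite_series (f : ℝ → ℝ) (hf : ContDiff ℝ (⊤ : ℕ∞) f)
    (hsupp : HasCompactSupport f) (τ β : ℝ) (hτ : 0 < τ) (hβ : 0 < β)
    (u : ℝ → ℝ)
    (hu : ∀ ξ : ℝ, u ξ =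
      (1 / (2 * Real.sqrt (Real.pi * τ))) * ∫ η : ℝ, Real.exp (-(ξ - η) ^ 2 / (4 * τ)) * f η)
    (x : ℝ) :
    ∃ s : ℝ,
      HasSum
        (fun j : ℕ =>
          (1 / (2 * Real.sqrt β)) ^ j * hermiteH j (x / (2 * Real.sqrt β)) *
            ((τ + β) ^ ((j : ℝ) / 2) / (j.factorial : ℝ)) *
            ∫ ξ : ℝ, hermiteH j (ξ / (2 * Real.sqrt (τ + β))) * u ξ)
        s ∧
      f x = Real.exp (-x ^ 2 / (4 * β)) / (2 * Real.sqrt (Real.pi * β)) * s := by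
  have hb : √β ≠ 0 := (Real.sqrt_pos.2 hβ).ne'
  have hb2 : √β ^ 2 = β := Real.sq_sqrt hβ.le
  have ha : √(τ + β) ≠ 0 := (Real.sqrt_pos.2 (by positivity)).ne'
  have hF : ContDiff ℝ (⊤ : ℕ∞) fun y => f (2 * √β * y) := by fun_prop
  have hFs : HasCompactSupport fun y => f (2 * √β * y) :=
    hsupp.comp_homeomorph (Homeomorph.mulLeft₀ (2 * √β) (by positivity))
  have key := (hasSum_hermiteH_expansion hF hFs (x / (2 * √β))).mul_left (2 * √β)
  rw [mul_div_cancel₀ x (by positivity : 2 * √β ≠ 0)] at key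
  refine ⟨2 * √β * (√π * Real.exp ((x / (2 * √β)) ^ 2) * f x), ?_, ?_⟩
  · have hterm (j : ℕ) : (1 / (2 * √β)) ^ j * hermiteH j (x / (2 * √β)) *
        ((τ + β) ^ ((j : ℝ) / 2) / (j.factorial : ℝ)) *
          ∫ ξ : ℝ, hermiteH j (ξ / (2 * √(τ + β))) * u ξ =
        2 * √β * (hermiteH j (x / (2 * √β)) / (2 ^ j * j.factorial) *
          ∫ y, hermiteH j y * f (2 * √β * y)) := by
      have hp : (τ + β) ^ ((j : ℝ) / 2) = √(τ + β) ^ j := by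
        rw [Real.sqrt_eq_rpow, ← Real.rpow_natCast, ← Real.rpow_mul (by positivity)]
        congr 1
        ring
      have hc := Measure.integral_comp_mul_left
        (fun η => hermiteH j (η / (2 * √β)) * f η) (2 * √β)
      simp only [mul_div_cancel_left₀ _ (by positivity : 2 * √β ≠ 0), smul_eq_mul] at hc
      rw [abs_of_nonneg (by positivity)] at hc
      simp only [hu]
      rw [integral_hermiteH_mul_heatFlow hf.continuous hsupp hτ hβ, hp, hc, div_pow, div_pow,
        mul_pow, one_pow]
      field_simp
    simpa only [hterm] using key
  · rw [div_pow, mul_pow, hb2, Real.sqrt_mul pi_pos.le, neg_div, Real.exp_neg]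
    norm_num
    have : √π ≠ 0 := (Real.sqrt_pos.2 pi_pos).ne'
    field_simp
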